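/- Let A ⊆ H be an affine commutative-by-finite Hopf algebra satisfying (CoSplit), with A semiprime or central in H, or H pointed, and set G̃_H := {Π°(χ_g) : g ∈ G_H} ⊆ H°. Then: (i) G̃_H is a subgroup of the group of units of H° and Π° restricts to a group isomorphism from the group-likes G_H of A° onto G̃_H; (ii) the subalgebra of H° generated by G̃_H is the group algebra kG̃_H ≅ kG_H; (iii) for each g, H̄*Π°(χ_g) = Π°(χ_g)H̄* is free of rank 1 as an H̄*-bimodule, and the subalgebra ⟨H̄*, G̃_H⟩ = ⊕_{g ∈ G_H} H̄*Π°(χ_g) is a skew group algebra H̄* # G̃_H contained in the subcoalgebra k̂G_H; (iv) k̂G_H ⊇ ⊕_{orbits g}⊕_{h∼g}(H/Hm_h)* ⊇ H̄* # G̃_H, and if A is a domain the second inclusion is an equality. -/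

import Mathlib

open TensorProduct LinearMap Coalgebra

namespace Paper

noncomputable section

variable (k : Type) [Field k]

section Coalg

variable {C : Type} [AddCommMonoid C] [Module k C] [Coalgebra k C]

/-- Convolution product on the linear dual of a coalgebra. -/
noncomputable def conv (f g : Module.Dual k C) : Module.Dual k C :=
  (TensorProduct.lid k k).toLinearMap ∘ₗ TensorProduct.map f g ∘ₗ Coalgebra.comul

/-- The unit of the convolution algebra on the dual: the counit. -/
noncomputable def convOne : Module.Dual k C := Coalgebra.counit

/-- Iterated convolution power. -/
noncomputable def convPow (f : Module.Dual k C) : ℕ → Module.Dual k C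
  | 0 => convOne k
  | n + 1 => conv k f (convPow f n)

end Coalg

/-- The finite dual of an algebra: functionals vanishing on a two-sided ideal
of finite codimension. -/
def finDual (H : Type) [Ring H] [Algebra k H] : Set (Module.Dual k H) :=
  {f | ∃ I : Submodule k H, (∀ (h : H), ∀ x ∈ I, h * x ∈ I ∧ x * h ∈ I) ∧
    I ≤ LinearMap.ker f ∧ FiniteDimensional k (H ⧸ I)}

section Hopf

variable (H : Type) [Ring H] [HopfAlgebra k H]

/-- Left adjoint action `(ad_ℓ h)(a) = Σ h₁ a S(h₂)`. -/
noncomputable def adl (h a : H) : H :=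
  TensorProduct.lift (((LinearMap.mul k H).comp (LinearMap.mulRight k a)).compl₂
    (HopfAlgebra.antipode (R := k))) (Coalgebra.comul h)

/-- Right adjoint action `(ad_r h)(a) = Σ S(h₁) a h₂`. -/
noncomputable def adr (h a : H) : H :=
  TensorProduct.lift ((LinearMap.mul k H).comp ((LinearMap.mulRight k a) ∘ₗ
    (HopfAlgebra.antipode (R := k)))) (Coalgebra.comul h)

/-- Left adjoint action on the dual: `(ad_ℓ φ)(f) = Σ φ₁ f S°(φ₂)`, i.e.
`h ↦ Σ φ(h₁ S(h₃)) f(h₂)`. -/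
noncomputable def adld (φ f : Module.Dual k H) : Module.Dual k H :=
  (TensorProduct.lid k k).toLinearMap ∘ₗ
    TensorProduct.map (φ ∘ₗ LinearMap.mul' k H ∘ₗ
      (HopfAlgebra.antipode (R := k)).lTensor H) f ∘ₗ
    (TensorProduct.assoc k H H H).symm.toLinearMap ∘ₗ
    ((TensorProduct.comm k H H).toLinearMap.lTensor H) ∘ₗ
    ((Coalgebra.comul (R := k) (A := H)).lTensor H) ∘ₗ
    Coalgebra.comul

/-- Right adjoint action on the dual: `(ad_r φ)(f) = Σ S°(φ₁) f φ₂`, i.e.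
`h ↦ Σ φ(S(h₁) h₃) f(h₂)`. -/
noncomputable def adrd (φ f : Module.Dual k H) : Module.Dual k H :=
  (TensorProduct.lid k k).toLinearMap ∘ₗ
    TensorProduct.map (φ ∘ₗ LinearMap.mul' k H ∘ₗ
      (HopfAlgebra.antipode (R := k)).rTensor H) f ∘ₗ
    (TensorProduct.assoc k H H H).symm.toLinearMap ∘ₗ
    ((TensorProduct.comm k H H).toLinearMap.lTensor H) ∘ₗ
    ((Coalgebra.comul (R := k) (A := H)).lTensor H) ∘ₗ
    Coalgebra.comul

/-- A submodule is a subcoalgebra if its image under `comul` lies in `V ⊗ V`. -/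
def IsSubcoalgebra (V : Submodule k H) : Prop :=
  ∀ x ∈ V, Coalgebra.comul (R := k) x ∈
    LinearMap.range (TensorProduct.map V.subtype V.subtype)

/-- A Hopf algebra is pointed if every simple subcoalgebra is one-dimensional. -/
def IsPointedHopf : Prop :=
  ∀ V : Submodule k H, IsSubcoalgebra k H V → V ≠ ⊥ →
    (∀ W : Submodule k H, W ≤ V → IsSubcoalgebra k H W → W = ⊥ ∨ W = V) →
    Module.finrank k ↥V = 1

/-- A coideal: `ε(X) = 0` and `Δ(X) ⊆ X ⊗ H + H ⊗ X`. -/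
def IsCoideal (X : Submodule k H) : Prop :=
  (∀ x ∈ X, Coalgebra.counit (R := k) x = 0) ∧
  (∀ x ∈ X, Coalgebra.comul (R := k) x ∈
    LinearMap.range (TensorProduct.map X.subtype (LinearMap.id (M := H))) ⊔
    LinearMap.range (TensorProduct.map (LinearMap.id (M := H)) X.subtype))

/-- `S` is a Hopf subalgebra of the finite dual `H°` (with its convolution
product; closure under the coproduct is expressed in pairing form). -/
def IsHopfSubalgSet (S : Set (Module.Dual k H)) : Prop :=
  S ⊆ finDual k H ∧ convOne k ∈ S ∧
  (∀ f g, f ∈ S → g ∈ S → f + g ∈ S ∧ conv k f g ∈ S) ∧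
  (∀ (c : k), ∀ f ∈ S, c • f ∈ S) ∧
  (∀ f ∈ S, f ∘ₗ HopfAlgebra.antipode (R := k) ∈ S) ∧
  (∀ f ∈ S, ∃ (n : ℕ) (s t : Fin n → Module.Dual k H),
    (∀ i, s i ∈ S ∧ t i ∈ S) ∧ ∀ x y : H, f (x * y) = ∑ i, s i x * t i y)

end Hopf

section Ext

variable (A : Type) [CommRing A] [HopfAlgebra k A]
variable (H : Type) [Ring H] [HopfAlgebra k H]

/-- The submodule `A⁺H` of `H` (image of the augmentation ideal times `H`). -/
def augHIdeal (ι : A →ₗ[k] H) : Submodule k H :=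
  Submodule.span k
    {x : H | ∃ (a : A) (h : H), Coalgebra.counit (R := k) a = 0 ∧ x = ι a * h}

/-- The subset of the dual of `H` corresponding to `H̄* = (H/A⁺H)*`:
functionals vanishing on `A⁺H`. -/
def hbarStar (ι : A →ₗ[k] H) : Set (Module.Dual k H) :=
  {f | ∀ x ∈ augHIdeal k A H ι, f x = 0}

/-- The tangential component `W(H°)`. -/
def tangential (ι : A →ₗ[k] H) : Set (Module.Dual k H) :=
  {f | f ∈ finDual k H ∧ ∃ n : ℕ, 0 < n ∧ ∀ x ∈ (augHIdeal k A H ι) ^ n, f x = 0}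

/-- The augmentation ideal of the commutative Hopf algebra `A`. -/
def augIdeal : Ideal A := RingHom.ker (Bialgebra.counitAlgHom k A)

/-- The irreducible component `A'` of `A°` containing the counit:
functionals vanishing on a power of the augmentation ideal. -/
def Aprime : Set (Module.Dual k A) :=
  {f | ∃ n : ℕ, 0 < n ∧ ∀ x ∈ (augIdeal k A) ^ n, f x = 0}

/-- The Lie algebra `𝔤` of `G_H`: primitive functionals on `A`. -/
def gLie : Set (Module.Dual k A) :=
  {f | f 1 = 0 ∧ ∀ x y : A, f (x * y) =
    f x * Coalgebra.counit (R := k) y + Coalgebra.counit (R := k) x * f y}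

/-- An ideal of `A` is `H̄`-stable if it is stable under the (left) adjoint
action of `H` on `A` (which factors through `H̄`). -/
def IsHStable (ι : A →ₗ[k] H) (I : Ideal A) : Prop :=
  ∀ (h : H), ∀ a ∈ I, ∃ b ∈ I, ι b = adl k H h (ι a)

/-- `mc` is the `H̄`-core of `m`: the largest `H̄`-stable ideal of `A`
contained in `m`. -/
def IsCore (ι : A →ₗ[k] H) (m mc : Ideal A) : Prop :=
  IsHStable k A H ι mc ∧ mc ≤ m ∧
    ∀ I : Ideal A, IsHStable k A H ι I → I ≤ m → I ≤ mc

/-- The submodule `H·J` of `H`, for an ideal `J` of `A`. -/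
def leftMul (ι : A →ₗ[k] H) (J : Ideal A) : Submodule k H :=
  Submodule.span k {x : H | ∃ (h : H), ∃ a ∈ J, x = h * ι a}

/-- The submodule `J·H` of `H`, for an ideal `J` of `A`. -/
def rightMul (ι : A →ₗ[k] H) (J : Ideal A) : Submodule k H :=
  Submodule.span k {x : H | ∃ (h : H), ∃ a ∈ J, x = ι a * h}

/-- The subcoalgebra `ĝ := (H/H m_g^{(H̄)})*` of `H°`, as a submodule of the dual. -/
def ghat (ι : A →ₗ[k] H) (core : Ideal A → Ideal A) (g : A →ₐ[k] k) :
    Submodule k (Module.Dual k H) :=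
  (leftMul k A H ι (core (RingHom.ker g))).dualAnnihilator

/-- The character component `k̂G_H` of `H°`. -/
def charComp (ι : A →ₗ[k] H) (core : Ideal A → Ideal A) :
    Set (Module.Dual k H) :=
  {f | ∃ s : Finset (A →ₐ[k] k), s.Nonempty ∧
    ∀ x ∈ ⨅ g ∈ s, leftMul k A H ι (core (RingHom.ker g)), f x = 0}

/-- Hypothesis (OrbSemi): all orbit algebras `A/m^{(H̄)}` are semisimple. -/
def OrbSemi (core : Ideal A → Ideal A) : Prop :=
  ∀ m : Ideal A, m.IsMaximal → IsSemisimpleRing (A ⧸ core m)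

/-- Restriction of functionals along `ι` : the map `ι° : H° → A°`. -/
def iotaDual (ι : A →ₗ[k] H) (f : Module.Dual k H) : Module.Dual k A := f ∘ₗ ι

/-- Coextension of functionals along the projection `Π : H → A`:
the map `Π° : A° → H°`. -/
def PiDual (p : H →ₗ[k] A) (α : Module.Dual k A) : Module.Dual k H := α ∘ₗ p

/-- `A ⊆ H` is an affine commutative-by-finite Hopf algebra, where the
inclusion of the commutative normal Hopf subalgebra `A` is recorded by the
injective Hopf algebra map `ι`. -/
structure CommByFinite (ι : A →ₗ[k] H) : Prop where
  ι_inj : Function.Injective ι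
  ι_one : ι 1 = 1
  ι_mul : ∀ a b : A, ι (a * b) = ι a * ι b
  ι_comul : ∀ a : A,
    Coalgebra.comul (R := k) (ι a) = TensorProduct.map ι ι (Coalgebra.comul a)
  ι_counit : ∀ a : A,
    Coalgebra.counit (R := k) (ι a) = Coalgebra.counit (R := k) a
  ι_antipode : ∀ a : A,
    ι (HopfAlgebra.antipode (R := k) a) = HopfAlgebra.antipode (R := k) (ι a)
  affine : ∃ s : Finset A, Algebra.adjoin k (s : Set A) = ⊤
  normal_left : ∀ (h : H) (a : A), adl k H h (ι a) ∈ Set.range ι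
  normal_right : ∀ (h : H) (a : A), adr k H h (ι a) ∈ Set.range ι
  finiteOver : ∃ s : Finset H,
    Submodule.span k {x : H | ∃ (a : A), ∃ y ∈ s, x = ι a * y} = ⊤

/-- The standing hypothesis: `A` is semiprime (reduced) or central in `H`,
or `H` is pointed. -/
def StandingHyp (ι : A →ₗ[k] H) : Prop :=
  IsReduced A ∨ (∀ (a : A) (h : H), ι a * h = h * ι a) ∨ IsPointedHopf k H

/-- `Π : H → A` is the projection of a direct sum decomposition
`H = A ⊕ X` of right `A`-modules. -/
structure IsSplitting (ι : A →ₗ[k] H) (p : H →ₗ[k] A) : Prop where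
  left_inv : ∀ a : A, p (ι a) = a
  right_linear : ∀ (h : H) (a : A), p (h * ι a) = p h * a

/-- Hypothesis (CoSplit) for a given splitting `Π`: the complement
`X = ker Π` is a coideal of `H`. -/
def CoSplit (p : H →ₗ[k] A) : Prop := IsCoideal k H (LinearMap.ker p)

end Ext

section Quot

variable (A : Type) [CommRing A] [HopfAlgebra k A]
variable (H : Type) [Ring H] [HopfAlgebra k H]
variable (Hb : Type) [Ring Hb] [HopfAlgebra k Hb]

/-- `π : H → H̄` realises `H̄` as the quotient Hopf algebra `H/A⁺H`. -/
structure IsHbarQuotient (ι : A →ₗ[k] H) (π : H →ₗ[k] Hb) : Prop where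
  π_surj : Function.Surjective π
  π_one : π 1 = 1
  π_mul : ∀ x y : H, π (x * y) = π x * π y
  π_comul : ∀ x : H,
    Coalgebra.comul (R := k) (π x) = TensorProduct.map π π (Coalgebra.comul x)
  π_counit : ∀ x : H,
    Coalgebra.counit (R := k) (π x) = Coalgebra.counit (R := k) x
  π_antipode : ∀ x : H,
    π (HopfAlgebra.antipode (R := k) x) = HopfAlgebra.antipode (R := k) (π x)
  π_ker : LinearMap.ker π = augHIdeal k A H ι
  findim : FiniteDimensional k Hb

/-- Composition with `π` : the map `π° : H̄* → H°`. -/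
def piDual (π : H →ₗ[k] Hb) (β : Module.Dual k Hb) : Module.Dual k H := β ∘ₗ π

end Quot

end

end Paper

namespace Paper

section Aux

variable {k : Type} [Field k]

section C
variable {C : Type} [AddCommMonoid C] [Module k C] [Coalgebra k C]

theorem conv_eq (f g : Module.Dual k C) :
    conv k f g = (WithConv.toConv f * WithConv.toConv g).ofConv := by
  ext x
  simp only [conv, LinearMap.comp_apply, LinearMap.convMul_def, LinearEquiv.coe_coe]
  generalize (Coalgebra.comul (R := k) x) = u
  induction u with
  | zero => simp
  | tmul a b => simp
  | add a b ha hb => simp_all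

theorem convOne_eq :
    (convOne k : Module.Dual k C) = (1 : WithConv (C →ₗ[k] k)).ofConv := by
  ext x
  simp [convOne, LinearMap.convOne_def]

theorem conv_assoc (f g h : Module.Dual k C) :
    conv k (conv k f g) h = conv k f (conv k g h) := by
  simp [conv_eq, mul_assoc]

theorem conv_convOne (f : Module.Dual k C) : conv k f (convOne k) = f := by
  rw [conv_eq, convOne_eq]; simp

theorem convOne_conv (f : Module.Dual k C) : conv k (convOne k) f = f := by
  rw [conv_eq, convOne_eq]; simp

theorem conv_zero_left (f : Module.Dual k C) : conv k 0 f = 0 := by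
  rw [conv_eq]; simp

end C

variable {A : Type} [CommRing A] [HopfAlgebra k A]
variable {H : Type} [Ring H] [HopfAlgebra k H]

theorem conv_semi {ι : A →ₗ[k] H} (hC : CommByFinite k A H ι)
    {f f' : Module.Dual k H} {φ ψ : Module.Dual k A}
    (hf : ∀ h a, f (h * ι a) = f h * φ a) (hf' : ∀ h a, f' (h * ι a) = f' h * ψ a)
    (h : H) (a : A) : conv k f f' (h * ι a) = conv k f f' h * conv k φ ψ a := by
  have key : ∀ (u : H ⊗[k] H) (v : A ⊗[k] A),
      (TensorProduct.lid k k) (TensorProduct.map f f' (u * TensorProduct.map ι ι v)) =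
      (TensorProduct.lid k k) (TensorProduct.map f f' u) *
      (TensorProduct.lid k k) (TensorProduct.map φ ψ v) := by
    intro u v
    induction u with
    | zero => simp
    | add a b ha hb => simp only [add_mul, map_add, ha, hb]
    | tmul x y =>
      induction v with
      | zero => simp
      | add a b ha hb => simp only [mul_add, map_add, ha, hb]
      | tmul b c =>
        simp only [TensorProduct.map_tmul, Algebra.TensorProduct.tmul_mul_tmul, hf, hf',
          TensorProduct.lid_tmul, smul_eq_mul]
        ring
  simp only [conv, LinearMap.comp_apply, LinearEquiv.coe_coe]
  rw [Bialgebra.comul_mul, hC.ι_comul]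
  exact key _ _

theorem p_counit {ι : A →ₗ[k] H} {p : H →ₗ[k] A} (hC : CommByFinite k A H ι)
    (hs : IsSplitting k A H ι p) (hco : CoSplit k A H p) (h : H) :
    Coalgebra.counit (R := k) (p h) = Coalgebra.counit (R := k) h := by
  have := hco.1 (h - ι (p h)) (by simp [hs.left_inv])
  rw [map_sub, hC.ι_counit, sub_eq_zero] at this
  exact this.symm

theorem p_comul {ι : A →ₗ[k] H} {p : H →ₗ[k] A} (hC : CommByFinite k A H ι)
    (hs : IsSplitting k A H ι p) (hco : CoSplit k A H p) (h : H) :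
    Coalgebra.comul (R := k) (p h) = TensorProduct.map p p (Coalgebra.comul (R := k) h) := by
  have h1 := hco.2 (h - ι (p h)) (by simp [hs.left_inv])
  have h2 : TensorProduct.map p p (Coalgebra.comul (R := k) (h - ι (p h))) = 0 := by
    rw [← LinearMap.mem_ker]
    refine (sup_le ?_ ?_ : _ ≤ LinearMap.ker (TensorProduct.map p p)) h1
    · rintro _ ⟨u, rfl⟩
      rw [LinearMap.mem_ker]
      induction u with
      | zero => simp
      | add a b ha hb => simp only [map_add, ha, hb, add_zero]
      | tmul x y =>
        have : p x = 0 := x.2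
        simp [this]
    · rintro _ ⟨u, rfl⟩
      rw [LinearMap.mem_ker]
      induction u with
      | zero => simp
      | add a b ha hb => simp only [map_add, ha, hb, add_zero]
      | tmul x y =>
        have : p y = 0 := y.2
        simp [this]
  rw [map_sub, map_sub, sub_eq_zero, hC.ι_comul] at h2
  rw [h2]
  have h3 : p ∘ₗ ι = LinearMap.id := by ext a; simp [hs.left_inv]
  have h4 := TensorProduct.map_comp p p ι ι
  rw [h3, TensorProduct.map_id] at h4
  exact LinearMap.congr_fun h4 _

theorem PiDual_conv {ι : A →ₗ[k] H} {p : H →ₗ[k] A} (hC : CommByFinite k A H ι)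
    (hs : IsSplitting k A H ι p) (hco : CoSplit k A H p) (α β : Module.Dual k A) :
    conv k (PiDual k A H p α) (PiDual k A H p β) = PiDual k A H p (conv k α β) := by
  ext h
  simp only [conv, PiDual, LinearMap.comp_apply]
  rw [p_comul hC hs hco, TensorProduct.map_comp]
  rfl

theorem PiDual_one {ι : A →ₗ[k] H} {p : H →ₗ[k] A} (hC : CommByFinite k A H ι)
    (hs : IsSplitting k A H ι p) (hco : CoSplit k A H p) :
    PiDual k A H p (convOne k) = convOne k := by
  ext h
  exact p_counit hC hs hco h

/-- inverse of a character -/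
noncomputable def chInv (g : A →ₐ[k] k) : Module.Dual k A :=
  g.toLinearMap ∘ₗ HopfAlgebra.antipode (R := k)

theorem conv_chInv (g : A →ₐ[k] k) : conv k g.toLinearMap (chInv g) = convOne k := by
  ext a
  have h1 : ∀ u : A ⊗[k] A, (TensorProduct.lid k k)
      (TensorProduct.map g.toLinearMap (chInv g) u) =
      g (LinearMap.mul' k A ((HopfAlgebra.antipode (R := k)).lTensor A u)) := by
    intro u
    induction u with
    | zero => simp
    | add a b ha hb => simp only [map_add, ha, hb]
    | tmul x y => simp [chInv]
  simp only [conv, LinearMap.comp_apply, LinearEquiv.coe_coe, h1]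
  rw [HopfAlgebra.mul_antipode_lTensor_comul_apply]
  simp [convOne]

theorem chInv_conv (g : A →ₐ[k] k) : conv k (chInv g) g.toLinearMap = convOne k := by
  ext a
  have h1 : ∀ u : A ⊗[k] A, (TensorProduct.lid k k)
      (TensorProduct.map (chInv g) g.toLinearMap u) =
      g (LinearMap.mul' k A ((HopfAlgebra.antipode (R := k)).rTensor A u)) := by
    intro u
    induction u with
    | zero => simp
    | add a b ha hb => simp only [map_add, ha, hb]
    | tmul x y => simp [chInv]
  simp only [conv, LinearMap.comp_apply, LinearEquiv.coe_coe, h1]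
  rw [HopfAlgebra.mul_antipode_rTensor_comul_apply]
  simp [convOne]

theorem chInv_mul (g : A →ₐ[k] k) (a b : A) : chInv g (a * b) = chInv g a * chInv g b := by
  simp [chInv, HopfAlgebra.antipode_mul_distrib]

theorem adl_counit {ι : A →ₗ[k] H} (hC : CommByFinite k A H ι) (h : H) (a : A)
    (ha : Coalgebra.counit (R := k) a = 0) :
    Coalgebra.counit (R := k) (adl k H h (ι a)) = 0 := by
  unfold adl
  generalize (Coalgebra.comul (R := k) h) = u
  induction u with
  | zero => simp
  | add a b ha hb => simp only [map_add, ha, hb, add_zero]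
  | tmul x y => simp [hC.ι_counit, ha]

theorem adr_counit {ι : A →ₗ[k] H} (hC : CommByFinite k A H ι) (h : H) (a : A)
    (ha : Coalgebra.counit (R := k) a = 0) :
    Coalgebra.counit (R := k) (adr k H h (ι a)) = 0 := by
  unfold adr
  generalize (Coalgebra.comul (R := k) h) = u
  induction u with
  | zero => simp
  | add a b ha hb => simp only [map_add, ha, hb, add_zero]
  | tmul x y => simp [hC.ι_counit, ha]

theorem adl_sum (h a : H) {J : Type} (r : Coalgebra.Repr k h J) :
    ∑ i ∈ r.index, adl k H (r.left i) a * r.right i = h * a := by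
  let F : H ⊗[k] (H ⊗[k] H) →ₗ[k] H :=
    LinearMap.mul' k H ∘ₗ TensorProduct.map (LinearMap.mulRight k a)
      (LinearMap.mul' k H ∘ₗ (HopfAlgebra.antipode (R := k)).rTensor H)
  have h1 : ∀ u : H ⊗[k] H, ∀ y : H,
      TensorProduct.lift (((LinearMap.mul k H).comp (LinearMap.mulRight k a)).compl₂
        (HopfAlgebra.antipode (R := k))) u * y = F (TensorProduct.assoc k H H H (u ⊗ₜ y)) := by
    intro u y
    induction u with
    | zero => simp
    | add a b ha hb => simp only [map_add, add_mul, TensorProduct.add_tmul, ha, hb]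
    | tmul x z => simp [F, mul_assoc]
  have h2 : ∀ u : H ⊗[k] H, F ((Coalgebra.comul (R := k)).lTensor H u) =
      (TensorProduct.rid k H ((Coalgebra.counit (R := k)).lTensor H u)) * a := by
    intro u
    induction u with
    | zero => simp
    | add a b ha hb => simp only [map_add, add_mul, ha, hb]
    | tmul x z =>
      simp only [F, LinearMap.lTensor_tmul, LinearMap.comp_apply, TensorProduct.map_tmul,
        HopfAlgebra.mul_antipode_rTensor_comul_apply, LinearMap.mul'_apply,
        LinearMap.mulRight_apply, TensorProduct.rid_tmul]
      rw [Algebra.algebraMap_eq_smul_one]; simp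
  have h3 : ∀ i, adl k H (r.left i) a * r.right i =
      F (TensorProduct.assoc k H H H ((Coalgebra.comul (R := k)).rTensor H
        (r.left i ⊗ₜ r.right i))) := fun i => h1 _ _
  simp only [h3]
  rw [← map_sum, ← map_sum, ← map_sum, r.eq, Coalgebra.coassoc_apply, h2,
    Coalgebra.lTensor_counit_comul]
  simp

theorem adr_sum (h a : H) {J : Type} (r : Coalgebra.Repr k h J) :
    ∑ i ∈ r.index, r.left i * adr k H (r.right i) a = a * h := by
  let F : (H ⊗[k] H) ⊗[k] H →ₗ[k] H :=
    LinearMap.mul' k H ∘ₗ TensorProduct.map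
      (LinearMap.mul' k H ∘ₗ (HopfAlgebra.antipode (R := k)).lTensor H) (LinearMap.mulLeft k a)
  have h1 : ∀ u : H ⊗[k] H, ∀ y : H,
      y * TensorProduct.lift ((LinearMap.mul k H).comp ((LinearMap.mulRight k a) ∘ₗ
        (HopfAlgebra.antipode (R := k)))) u =
      F ((TensorProduct.assoc k H H H).symm (y ⊗ₜ u)) := by
    intro u y
    induction u with
    | zero => simp
    | add a b ha hb => simp only [map_add, mul_add, TensorProduct.tmul_add, ha, hb]
    | tmul x z => simp [F, mul_assoc]
  have h2 : ∀ u : H ⊗[k] H, F ((Coalgebra.comul (R := k)).rTensor H u) =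
      a * (TensorProduct.lid k H ((Coalgebra.counit (R := k)).rTensor H u)) := by
    intro u
    induction u with
    | zero => simp
    | add a b ha hb => simp only [map_add, mul_add, ha, hb]
    | tmul x z =>
      simp only [F, LinearMap.rTensor_tmul, LinearMap.comp_apply, TensorProduct.map_tmul,
        HopfAlgebra.mul_antipode_lTensor_comul_apply, LinearMap.mul'_apply,
        LinearMap.mulLeft_apply, TensorProduct.lid_tmul]
      rw [Algebra.algebraMap_eq_smul_one]; simp
  have h3 : ∀ i, r.left i * adr k H (r.right i) a =
      F ((TensorProduct.assoc k H H H).symm ((Coalgebra.comul (R := k)).lTensor H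
        (r.left i ⊗ₜ r.right i))) := fun i => h1 _ _
  simp only [h3]
  rw [← map_sum, ← map_sum, ← map_sum, r.eq, Coalgebra.coassoc_symm_apply, h2,
    Coalgebra.rTensor_counit_comul]
  simp

theorem mul_mem_aug {ι : A →ₗ[k] H} (hC : CommByFinite k A H ι) (h : H) (a : A)
    (ha : Coalgebra.counit (R := k) a = 0) : h * ι a ∈ augHIdeal k A H ι := by
  rw [← adl_sum h (ι a) (Coalgebra.Repr.arbitrary k h)]
  refine Submodule.sum_mem _ fun i _ => Submodule.subset_span ?_
  obtain ⟨b, hb⟩ := hC.normal_left ((Coalgebra.Repr.arbitrary k h).left i) a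
  refine ⟨b, _, ?_, by rw [hb]⟩
  rw [← hC.ι_counit, hb, adl_counit hC _ _ ha]

/-- functionals killing `H A⁺` kill `A⁺ H` -/
theorem mem_hbar {ι : A →ₗ[k] H} (hC : CommByFinite k A H ι) (f : Module.Dual k H)
    (hf : ∀ h a, Coalgebra.counit (R := k) a = 0 → f (h * ι a) = 0) :
    f ∈ hbarStar k A H ι := by
  intro x hx
  have : augHIdeal k A H ι ≤ LinearMap.ker f := by
    refine Submodule.span_le.2 ?_
    rintro _ ⟨a, h, ha, rfl⟩
    change f _ = 0
    rw [← adr_sum h (ι a) (Coalgebra.Repr.arbitrary k h), map_sum]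
    refine Finset.sum_eq_zero fun i _ => ?_
    obtain ⟨b, hb⟩ := hC.normal_right ((Coalgebra.Repr.arbitrary k h).right i) a
    rw [← hb]
    apply hf
    rw [← hC.ι_counit, hb, adr_counit hC _ _ ha]
  exact this hx

theorem hbar_semi {ι : A →ₗ[k] H} (hC : CommByFinite k A H ι) {f : Module.Dual k H}
    (hf : f ∈ hbarStar k A H ι) (h : H) (a : A) :
    f (h * ι a) = f h * (convOne k : Module.Dual k A) a := by
  have h1 := hf _ (mul_mem_aug hC h (a - algebraMap k A (Coalgebra.counit (R := k) a)) (by simp))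
  rw [Algebra.algebraMap_eq_smul_one, map_sub, map_smul, hC.ι_one, mul_sub, map_sub,
    sub_eq_zero] at h1
  rw [h1]
  simp [convOne, mul_comm]

theorem hbar_of_semi {ι : A →ₗ[k] H} (hC : CommByFinite k A H ι) {f : Module.Dual k H}
    (hf : ∀ h a, f (h * ι a) = f h * (convOne k : Module.Dual k A) a) :
    f ∈ hbarStar k A H ι := by
  refine mem_hbar hC f fun h a ha => ?_
  rw [hf]
  simp [convOne, ha]

theorem aug_ideal {ι : A →ₗ[k] H} (hC : CommByFinite k A H ι) (h : H) :
    ∀ x ∈ augHIdeal k A H ι, h * x ∈ augHIdeal k A H ι ∧ x * h ∈ augHIdeal k A H ι := by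
  intro x hx
  induction hx using Submodule.span_induction with
  | mem x hx =>
    obtain ⟨a, y, ha, rfl⟩ := hx
    constructor
    · have h1 := mul_mem_aug hC h a ha
      rw [← mul_assoc]
      generalize h * ι a = z at h1
      induction h1 using Submodule.span_induction with
      | mem z hz =>
        obtain ⟨b, w, hb, rfl⟩ := hz
        exact Submodule.subset_span ⟨b, w * y, hb, by rw [mul_assoc]⟩
      | zero => simp
      | add u v _ _ hu hv => rw [add_mul]; exact add_mem hu hv
      | smul c u _ hu => rw [smul_mul_assoc]; exact Submodule.smul_mem _ _ hu
    · exact Submodule.subset_span ⟨a, y * h, ha, by rw [mul_assoc]⟩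
  | zero => simp
  | add u v _ _ hu hv =>
    rw [add_mul, mul_add]; exact ⟨add_mem hu.1 hv.1, add_mem hu.2 hv.2⟩
  | smul c u _ hu =>
    rw [smul_mul_assoc, mul_smul_comm]
    exact ⟨Submodule.smul_mem _ _ hu.1, Submodule.smul_mem _ _ hu.2⟩

theorem aug_findim {ι : A →ₗ[k] H} (hC : CommByFinite k A H ι) :
    FiniteDimensional k (H ⧸ augHIdeal k A H ι) := by
  obtain ⟨s, hs⟩ := hC.finiteOver
  classical
  refine ⟨⟨s.image (augHIdeal k A H ι).mkQ, ?_⟩⟩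
  rw [eq_top_iff, ← (augHIdeal k A H ι).range_mkQ, ← Submodule.map_top, ← hs,
    Submodule.map_span, Submodule.span_le]
  rintro _ ⟨_, ⟨a, y, hy, rfl⟩, rfl⟩
  have h1 : (augHIdeal k A H ι).mkQ (ι a * y) =
      (Coalgebra.counit (R := k) a) • (augHIdeal k A H ι).mkQ y := by
    rw [← map_smul, ← sub_eq_zero, ← map_sub, Submodule.mkQ_apply,
      Submodule.Quotient.mk_eq_zero]
    refine Submodule.subset_span ⟨a - algebraMap k A (Coalgebra.counit (R := k) a), y,
      by simp, ?_⟩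
    rw [Algebra.algebraMap_eq_smul_one, map_sub, map_smul, hC.ι_one, sub_mul, smul_mul_assoc,
      one_mul]
  rw [h1]
  exact Submodule.smul_mem _ _ (Submodule.subset_span (by simpa using ⟨y, hy, rfl⟩))

theorem hbar_fin {ι : A →ₗ[k] H} (hC : CommByFinite k A H ι) {f : Module.Dual k H}
    (hf : f ∈ hbarStar k A H ι) : f ∈ finDual k H ∩ hbarStar k A H ι :=
  ⟨⟨augHIdeal k A H ι, fun h => aug_ideal hC h, fun x hx => hf x hx, aug_findim hC⟩, hf⟩

theorem PiDual_semi {ι : A →ₗ[k] H} {p : H →ₗ[k] A} (hs : IsSplitting k A H ι p)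
    (α : Module.Dual k A) (hα : ∀ a b, α (a * b) = α a * α b) (h : H) (a : A) :
    PiDual k A H p α (h * ι a) = PiDual k A H p α h * α a := by
  simp [PiDual, hs.right_linear, hα]

theorem mem_leftMul_ann {ι : A →ₗ[k] H} (g : A →ₐ[k] k) {f : Module.Dual k H}
    (hf : ∀ h a, f (h * ι a) = f h * g.toLinearMap a) :
    f ∈ (leftMul k A H ι (RingHom.ker g)).dualAnnihilator := by
  rw [Submodule.mem_dualAnnihilator]
  intro x hx
  have : leftMul k A H ι (RingHom.ker g) ≤ LinearMap.ker f := by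
    refine Submodule.span_le.2 ?_
    rintro _ ⟨h, a, ha, rfl⟩
    have ha' : g a = 0 := ha
    change f _ = 0
    simp [hf, ha']
  exact this hx

theorem semi_of_ann {ι : A →ₗ[k] H} (hC : CommByFinite k A H ι) (g : A →ₐ[k] k)
    {f : Module.Dual k H} (hf : f ∈ (leftMul k A H ι (RingHom.ker g)).dualAnnihilator)
    (h : H) (a : A) : f (h * ι a) = f h * g.toLinearMap a := by
  rw [Submodule.mem_dualAnnihilator] at hf
  have h1 := hf (h * ι (a - algebraMap k A (g a)))
    (Submodule.subset_span ⟨h, _, by simp [RingHom.mem_ker], rfl⟩)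
  rw [Algebra.algebraMap_eq_smul_one, map_sub, map_smul, hC.ι_one, mul_sub, map_sub,
    sub_eq_zero] at h1
  rw [h1]
  simp [mul_comm]

theorem leftMul_mono (ι : A →ₗ[k] H) {I J : Ideal A} (h : I ≤ J) :
    leftMul k A H ι I ≤ leftMul k A H ι J :=
  Submodule.span_mono fun _ ⟨x, a, ha, e⟩ => ⟨x, a, h ha, e⟩

theorem char_li : LinearIndependent k (fun g : A →ₐ[k] k => g.toLinearMap) := by
  have h := linearIndependent_monoidHom A k
  have h2 := h.comp (fun g : A →ₐ[k] k => (g : A →* k)) (by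
    intro g g' e
    ext a
    exact DFunLike.congr_fun e a)
  refine LinearIndependent.of_comp
    ({ toFun := fun f => (f : A → k), map_add' := fun _ _ => rfl, map_smul' := fun _ _ => rfl } :
      Module.Dual k A →ₗ[k] (A → k)) h2

theorem Pi_li {ι : A →ₗ[k] H} {p : H →ₗ[k] A} (hs : IsSplitting k A H ι p) :
    LinearIndependent k (fun g : A →ₐ[k] k => PiDual k A H p g.toLinearMap) := by
  let L : Module.Dual k H →ₗ[k] Module.Dual k A :=
    { toFun := fun f => f ∘ₗ ι, map_add' := fun _ _ => rfl, map_smul' := fun _ _ => rfl }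
  refine LinearIndependent.of_comp L ?_
  have : (L ∘ fun g : A →ₐ[k] k => PiDual k A H p g.toLinearMap) =
      fun g : A →ₐ[k] k => g.toLinearMap := by
    funext g
    ext a
    simp [L, PiDual, hs.left_inv]
  rw [this]
  exact char_li

end Aux

end Paper

open Paper in
/-- Under (CoSplit), with `G̃_H = {Π°(χ_g)}`: (i) `G̃_H` is a
group of units of `H°` isomorphic to `G_H` via `Π°`; (ii) the subalgebra it
generates is the group algebra `kG̃_H ≅ kG_H`; (iii) `H̄*Π°(χ_g) = Π°(χ_g)H̄*`
is free of rank 1 over `H̄*` and `⟨H̄*, G̃_H⟩ = ⊕_g H̄*Π°(χ_g)` is a skew group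
algebra contained in `k̂G_H`; (iv) `k̂G_H ⊇ ⊕_{h}(H/Hm_h)* ⊇ H̄* # G̃_H`, the
second inclusion being an equality when `A` is a domain. -/
theorem statement_14
    (k : Type) [Field k] [IsAlgClosed k]
    (A : Type) [CommRing A] [HopfAlgebra k A]
    (H : Type) [Ring H] [HopfAlgebra k H]
    (ι : A →ₗ[k] H) (p : H →ₗ[k] A)
    (hCbF : CommByFinite k A H ι)
    (hyp : StandingHyp k A H ι)
    (hsplit : IsSplitting k A H ι p)
    (hcosplit : CoSplit k A H p)
    (core : Ideal A → Ideal A)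
    (hcore : ∀ m : Ideal A, m.IsMaximal → IsCore k A H ι m (core m)) :
    -- (i) `Π°` maps the group of characters isomorphically onto a group
    -- `G̃_H` of units of `H°`:
    PiDual k A H p (Bialgebra.counitAlgHom k A).toLinearMap = convOne k ∧
    (∀ g h gh : A →ₐ[k] k,
      (∀ a : A, gh a = conv k g.toLinearMap h.toLinearMap a) →
      conv k (PiDual k A H p g.toLinearMap) (PiDual k A H p h.toLinearMap)
        = PiDual k A H p gh.toLinearMap) ∧
    (∀ g ginv : A →ₐ[k] k,
      (∀ a : A, ginv a = g (HopfAlgebra.antipode (R := k) a)) →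
      conv k (PiDual k A H p g.toLinearMap) (PiDual k A H p ginv.toLinearMap)
        = convOne k ∧
      conv k (PiDual k A H p ginv.toLinearMap) (PiDual k A H p g.toLinearMap)
        = convOne k) ∧
    (∀ g h : A →ₐ[k] k,
      PiDual k A H p g.toLinearMap = PiDual k A H p h.toLinearMap → g = h) ∧
    -- (ii) the `Π°(χ_g)` are linearly independent, so they span the group
    -- algebra `kG̃_H ≅ kG_H`
    LinearIndependent k
      (fun g : A →ₐ[k] k => PiDual k A H p g.toLinearMap) ∧
    -- (iii) `H̄*Π°(χ_g) = Π°(χ_g)H̄*`, free of rank 1 as `H̄*`-(bi)module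
    (∀ (g : A →ₐ[k] k), ∀ t ∈ finDual k H ∩ hbarStar k A H ι,
      (∃ t' ∈ finDual k H ∩ hbarStar k A H ι,
        conv k (PiDual k A H p g.toLinearMap) t
          = conv k t' (PiDual k A H p g.toLinearMap)) ∧
      (∃ t'' ∈ finDual k H ∩ hbarStar k A H ι,
        conv k t (PiDual k A H p g.toLinearMap)
          = conv k (PiDual k A H p g.toLinearMap) t'')) ∧
    (∀ (g : A →ₐ[k] k), ∀ t ∈ finDual k H ∩ hbarStar k A H ι,
      conv k t (PiDual k A H p g.toLinearMap) = 0 → t = 0) ∧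
    -- `⟨H̄*, G̃_H⟩ = ⊕_g H̄*Π°(χ_g)`: directness of the sum ...
    (∀ (n : ℕ) (g : Fin n → (A →ₐ[k] k)) (t : Fin n → Module.Dual k H),
      Function.Injective g →
      (∀ i, t i ∈ finDual k H ∩ hbarStar k A H ι) →
      (∑ i, conv k (t i) (PiDual k A H p (g i).toLinearMap)) = 0 →
      ∀ i, t i = 0) ∧
    -- ... and this skew group algebra is contained in the subcoalgebra `k̂G_H`
    (∀ (g : A →ₐ[k] k), ∀ t ∈ finDual k H ∩ hbarStar k A H ι,
      conv k t (PiDual k A H p g.toLinearMap) ∈ charComp k A H ι core) ∧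
    -- (iv) `ĝ ⊇ ⊕_{h∼g}(H/Hm_h)*` and `(H/Hm_h)* ⊇ H̄*Π°(χ_h)` ...
    (∀ g h : A →ₐ[k] k, core (RingHom.ker h) = core (RingHom.ker g) →
      (leftMul k A H ι (RingHom.ker h)).dualAnnihilator ≤ ghat k A H ι core g) ∧
    (∀ (h : A →ₐ[k] k), ∀ t ∈ finDual k H ∩ hbarStar k A H ι,
      conv k t (PiDual k A H p h.toLinearMap)
        ∈ (leftMul k A H ι (RingHom.ker h)).dualAnnihilator) ∧
    -- ... with equality `(H/Hm_h)* = H̄*Π°(χ_h)` when `A` is a domain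
    (IsDomain A → ∀ (h : A →ₐ[k] k),
      ∀ f ∈ (leftMul k A H ι (RingHom.ker h)).dualAnnihilator,
      ∃ t ∈ finDual k H ∩ hbarStar k A H ι,
        f = conv k t (PiDual k A H p h.toLinearMap)) := by
  have hinv1 : ∀ g : A →ₐ[k] k, conv k (PiDual k A H p g.toLinearMap)
      (PiDual k A H p (chInv g)) = convOne k := fun g => by
    rw [PiDual_conv hCbF hsplit hcosplit, conv_chInv, PiDual_one hCbF hsplit hcosplit]
  have hinv2 : ∀ g : A →ₐ[k] k, conv k (PiDual k A H p (chInv g))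
      (PiDual k A H p g.toLinearMap) = convOne k := fun g => by
    rw [PiDual_conv hCbF hsplit hcosplit, chInv_conv, PiDual_one hCbF hsplit hcosplit]
  have hg : ∀ (g : A →ₐ[k] k) h a, PiDual k A H p g.toLinearMap (h * ι a) =
      PiDual k A H p g.toLinearMap h * g.toLinearMap a := fun g =>
    PiDual_semi hsplit _ (by simp)
  have hgi : ∀ (g : A →ₐ[k] k) h a, PiDual k A H p (chInv g) (h * ι a) =
      PiDual k A H p (chInv g) h * chInv g a := fun g =>
    PiDual_semi hsplit _ (chInv_mul g)
  have htg : ∀ (g : A →ₐ[k] k), ∀ t ∈ finDual k H ∩ hbarStar k A H ι, ∀ h a,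
      conv k t (PiDual k A H p g.toLinearMap) (h * ι a) =
        conv k t (PiDual k A H p g.toLinearMap) h * g.toLinearMap a := by
    intro g t ht h a
    rw [conv_semi hCbF (hbar_semi hCbF ht.2) (hg g), convOne_conv]
  have hcancel : ∀ (g : A →ₐ[k] k) (t : Module.Dual k H),
      conv k t (PiDual k A H p g.toLinearMap) = 0 → t = 0 := by
    intro g t ht
    rw [← conv_convOne t, ← hinv1 g, ← conv_assoc, ht, conv_zero_left]
  have hmax : ∀ g : A →ₐ[k] k, (RingHom.ker g).IsMaximal := fun g =>
    RingHom.ker_isMaximal_of_surjective g (fun c => ⟨algebraMap k A c, by simp⟩)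
  have hle : ∀ g : A →ₐ[k] k, (leftMul k A H ι (RingHom.ker g)).dualAnnihilator ≤
      ghat k A H ι core g := fun g =>
    Submodule.dualAnnihilator_anti (leftMul_mono ι (hcore _ (hmax g)).2.1)
  have hpsurj : Function.Surjective p := fun a => ⟨ι a, hsplit.left_inv a⟩
  have hinj : Function.Injective (PiDual k A H p) := by
    intro α β e
    ext a
    have := LinearMap.congr_fun e (ι a)
    simpa [PiDual, hsplit.left_inv] using this
  refine ⟨PiDual_one hCbF hsplit hcosplit, ?_, ?_, ?_, ?_, ?_, fun g t _ => hcancel g t, ?_, ?_,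
    ?_, fun h t ht => mem_leftMul_ann h (htg h t ht), ?_⟩
  · intro g h gh e
    rw [PiDual_conv hCbF hsplit hcosplit]
    congr 1
    ext a
    exact (e a).symm
  · intro g ginv e
    have : ginv.toLinearMap = chInv g := by
      ext a; exact e a
    rw [this]
    exact ⟨hinv1 g, hinv2 g⟩
  · intro g h e
    have := hinj e
    ext a
    exact LinearMap.congr_fun this a
  · exact Pi_li hsplit
  · intro g t ht
    constructor
    · refine ⟨conv k (conv k (PiDual k A H p g.toLinearMap) t) (PiDual k A H p (chInv g)),
        hbar_fin hCbF (hbar_of_semi hCbF fun h a => ?_), ?_⟩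
      · rw [conv_semi hCbF (conv_semi hCbF (hg g) (hbar_semi hCbF ht.2)) (hgi g),
          conv_convOne, conv_chInv]
      · rw [conv_assoc _ (PiDual k A H p (chInv g)), hinv2, conv_convOne]
    · refine ⟨conv k (PiDual k A H p (chInv g)) (conv k t (PiDual k A H p g.toLinearMap)),
        hbar_fin hCbF (hbar_of_semi hCbF fun h a => ?_), ?_⟩
      · rw [conv_semi hCbF (hgi g) (htg g t ht), chInv_conv]
      · rw [← conv_assoc, hinv1, convOne_conv]
  · intro n g t hgi ht hsum i
    apply hcancel (g i)
    ext h
    have h1 : ∑ j, (conv k (t j) (PiDual k A H p (g j).toLinearMap) h) • (g j).toLinearMap = 0 := by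
      ext a
      have := LinearMap.congr_fun hsum (h * ι a)
      simp only [LinearMap.sum_apply, htg _ _ (ht _)] at this
      simpa using this
    exact Fintype.linearIndependent_iff.1 (char_li.comp g hgi) _ h1 i
  · intro g t ht
    refine ⟨{g}, by simp, fun x hx => ?_⟩
    have := hle g (mem_leftMul_ann g (htg g t ht))
    rw [ghat, Submodule.mem_dualAnnihilator] at this
    exact this x (by simpa using hx)
  · intro g h e
    have := hle h
    rwa [ghat, e] at this
  · intro _ h f hf
    refine ⟨conv k f (PiDual k A H p (chInv h)),
      hbar_fin hCbF (hbar_of_semi hCbF fun x a => ?_), ?_⟩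
    · rw [conv_semi hCbF (semi_of_ann hCbF h hf) (hgi h), conv_chInv]
    · rw [conv_assoc, hinv2, conv_convOne]
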